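/- Let R = T × (0,H) be the x-periodic rectangle and ζ ∈ L^∞(T) with M = ‖ζ‖_∞. Then for every mean-zero q ∈ L²(R), ‖∂_y(ζq)‖²_{H⁻¹(R)} ≤ 9M²·(‖∂_x q‖²_{H⁻¹(R)} + ‖∂_y q‖²_{H⁻¹(R)}), for every aspect ratio H/L. -/

import Mathlib

open MeasureTheory Set

/-- The x-periodic rectangle `R = T × (0,H)`. -/
def RectR (L H : ℝ) : Set (ℝ × ℝ) := (Set.Ioo 0 L) ×ˢ (Set.Ioo 0 H)

/-- Test functions modeling `H¹₀(R)`: `C¹`, `L`-periodic in `x`, vanishing on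
the top and bottom walls. -/
def AdmRect (L H : ℝ) (u : ℝ × ℝ → ℝ) : Prop :=
  ContDiff ℝ 1 u ∧ (∀ x y, u (x + L, y) = u (x, y)) ∧
    (∀ x, u (x, 0) = 0) ∧ (∀ x, u (x, H) = 0)

/-- The squared energy (H¹ semi-)norm `‖∇u‖²_{L²(R)}`. -/
noncomputable def energyRect (L H : ℝ) (u : ℝ × ℝ → ℝ) : ℝ :=
  ∫ p in RectR L H, (fderiv ℝ u p (1, 0)) ^ 2 + (fderiv ℝ u p (0, 1)) ^ 2


theorem sq_intervalIntegral_le {a b : ℝ} (hab : a ≤ b) {f : ℝ → ℝ} (hf : Continuous f) :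
    (∫ t in a..b, f t) ^ 2 ≤ (b - a) * ∫ t in a..b, f t ^ 2 := by
  rcases hab.eq_or_lt with rfl | hlt
  · simp
  set c := ∫ t in a..b, f t with hc
  have hl : 0 < b - a := sub_pos.2 hlt
  have h0 : 0 ≤ ∫ t in a..b, (f t - c / (b - a)) ^ 2 :=
    intervalIntegral.integral_nonneg hab fun t _ => sq_nonneg _
  have h1 : ∫ t in a..b, (f t - c / (b - a)) ^ 2
      = (∫ t in a..b, f t ^ 2) - c ^ 2 / (b - a) := by
    have : ∀ t, (f t - c / (b - a)) ^ 2
        = f t ^ 2 - (2 * (c / (b - a))) * f t + (c / (b - a)) ^ 2 := fun t => by ring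
    simp_rw [this]
    rw [intervalIntegral.integral_add, intervalIntegral.integral_sub,
      intervalIntegral.integral_const_mul, intervalIntegral.integral_const, ← hc, smul_eq_mul]
    · field_simp
      ring
    all_goals exact Continuous.intervalIntegrable (by fun_prop) _ _
  rw [h1, sub_nonneg, div_le_iff₀ hl] at h0
  linarith

theorem integral_sub_mul_sub (a b : ℝ) :
    ∫ t in a..b, (t - a) * (b - t) = (b - a) ^ 3 / 6 := by
  have hd : ∀ t ∈ uIcc a b, HasDerivAt
      (fun t => (b - a) * (t - a) ^ 2 / 2 - (t - a) ^ 3 / 3) ((t - a) * (b - t)) t := by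
    intro t _
    have h := (hasDerivAt_id t).sub_const a
    refine HasDerivAt.congr_deriv
      ((((h.pow 2).const_mul (b - a)).div_const 2).sub ((h.pow 3).div_const 3)) ?_
    simp
    ring
  rw [intervalIntegral.integral_eq_sub_of_hasDerivAt hd
    (Continuous.intervalIntegrable (by fun_prop) _ _)]
  ring

theorem integral_sq_primitive_le {a b : ℝ} (hab : a < b) {f : ℝ → ℝ} (hf : Continuous f)
    (h0 : ∫ t in a..b, f t = 0) :
    ∫ t in a..b, (∫ s in a..t, f s) ^ 2 ≤ (b - a) ^ 2 / 6 * ∫ t in a..b, f t ^ 2 := by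
  set A := ∫ t in a..b, f t ^ 2
  have hl : 0 < b - a := sub_pos.2 hab
  have key : ∀ t ∈ Icc a b,
      (∫ s in a..t, f s) ^ 2 ≤ (A / (b - a)) * ((t - a) * (b - t)) := by
    intro t ht
    have hi : ∀ x y, IntervalIntegrable f volume x y := fun x y => hf.intervalIntegrable _ _
    have hi2 : ∀ x y, IntervalIntegrable (fun s => f s ^ 2) volume x y :=
      fun x y => Continuous.intervalIntegrable (by fun_prop) _ _
    have e1 := intervalIntegral.integral_add_adjacent_intervals (hi a t) (hi t b)
    have e2 := intervalIntegral.integral_add_adjacent_intervals (hi2 a t) (hi2 t b)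
    have c1 := sq_intervalIntegral_le ht.1 hf
    have c2 := sq_intervalIntegral_le ht.2 hf
    have e3 : (∫ s in t..b, f s) = -∫ s in a..t, f s := by linarith
    rw [e3, neg_sq] at c2
    have e4 : A = (∫ s in a..t, f s ^ 2) + ∫ s in t..b, f s ^ 2 := e2.symm
    rw [div_mul_eq_mul_div, le_div_iff₀ hl, e4]
    have m1 := mul_le_mul_of_nonneg_left c1 (sub_nonneg.2 ht.2)
    have m2 := mul_le_mul_of_nonneg_left c2 (sub_nonneg.2 ht.1)
    linarith
  have hV : Continuous fun t => ∫ s in a..t, f s :=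
    intervalIntegral.continuous_primitive (fun x y => hf.intervalIntegrable _ _) a
  calc ∫ t in a..b, (∫ s in a..t, f s) ^ 2
      ≤ ∫ t in a..b, (A / (b - a)) * ((t - a) * (b - t)) :=
        intervalIntegral.integral_mono_on hab.le
          (Continuous.intervalIntegrable (by fun_prop) _ _)
          (Continuous.intervalIntegrable (by fun_prop) _ _) key
    _ = (b - a) ^ 2 / 6 * A := by
        rw [intervalIntegral.integral_const_mul, integral_sub_mul_sub]
        field_simp

/-- A `C¹` bump supported in `[a, a + l]` with unit mass. -/
noncomputable def cellBump (a l t : ℝ) : ℝ := 30 * max 0 ((t - a) * (a + l - t)) ^ 2 / l ^ 5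

/-- The derivative of `cellBump`. -/
noncomputable def cellBumpDeriv (a l t : ℝ) : ℝ :=
  60 * max 0 ((t - a) * (a + l - t)) * (2 * a + l - 2 * t) / l ^ 5

theorem hasDerivAt_max_zero_sq (s : ℝ) :
    HasDerivAt (fun s : ℝ => max 0 s ^ 2) (2 * max 0 s) s := by
  rcases lt_trichotomy s 0 with h | rfl | h
  · rw [max_eq_left h.le, mul_zero]
    refine (hasDerivAt_const s (0 : ℝ)).congr_of_eventuallyEq ?_
    filter_upwards [Iio_mem_nhds h] with x hx
    simp [max_eq_left (le_of_lt (mem_Iio.1 hx))]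
  · rw [max_self, mul_zero, hasDerivAt_iff_isLittleO]
    have : (fun x : ℝ => max 0 x ^ 2 - max 0 0 ^ 2 - (x - 0) • (0 : ℝ)) =O[nhds 0]
        fun x => x ^ 2 := by
      refine Asymptotics.isBigO_of_le _ fun x => ?_
      rcases le_total 0 x with hx | hx <;> simp [hx, sq_nonneg]
    refine this.trans_isLittleO ?_
    simpa using (Asymptotics.isLittleO_pow_id (𝕜 := ℝ) (n := 2) one_lt_two)
  · rw [max_eq_right h.le]
    have h2 : HasDerivAt (fun x : ℝ => x ^ 2) (2 * s) s := by simpa using hasDerivAt_pow 2 s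
    refine h2.congr_of_eventuallyEq ?_
    filter_upwards [Ioi_mem_nhds h] with x hx
    simp [max_eq_right (le_of_lt (mem_Ioi.1 hx))]

theorem hasDerivAt_cellBump (a l t : ℝ) :
    HasDerivAt (cellBump a l) (cellBumpDeriv a l t) t := by
  have h1 : HasDerivAt (fun t => (t - a) * (a + l - t)) (2 * a + l - 2 * t) t := by
    refine HasDerivAt.congr_deriv (((hasDerivAt_id t).sub_const a).mul
      ((hasDerivAt_id t).const_sub (a + l))) ?_
    simp
    ring
  refine HasDerivAt.congr_deriv
    ((((hasDerivAt_max_zero_sq _).comp t h1).const_mul 30).div_const (l ^ 5)) ?_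
  simp only [cellBumpDeriv]
  ring

theorem continuous_cellBump (a l : ℝ) : Continuous (cellBump a l) := by
  unfold cellBump; fun_prop

theorem continuous_cellBumpDeriv (a l : ℝ) : Continuous (cellBumpDeriv a l) := by
  unfold cellBumpDeriv; fun_prop

theorem max_cell_of_mem {a l t : ℝ} (ht : t ∈ Icc a (a + l)) :
    max 0 ((t - a) * (a + l - t)) = (t - a) * (a + l - t) :=
  max_eq_right (mul_nonneg (sub_nonneg.2 ht.1) (sub_nonneg.2 ht.2))

theorem max_cell_of_notMem {a l t : ℝ} (hl : 0 ≤ l) (ht : t ∉ Ioo a (a + l)) :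
    max 0 ((t - a) * (a + l - t)) = 0 := by
  refine max_eq_left ?_
  rw [mem_Ioo, not_and_or, not_lt, not_lt] at ht
  rcases ht with h | h
  · exact mul_nonpos_of_nonpos_of_nonneg (by linarith) (by linarith)
  · exact mul_nonpos_of_nonneg_of_nonpos (by linarith) (by linarith)

theorem cellBump_of_notMem {a l t : ℝ} (hl : 0 ≤ l) (ht : t ∉ Ioo a (a + l)) :
    cellBump a l t = 0 := by simp [cellBump, max_cell_of_notMem hl ht]

theorem cellBumpDeriv_of_notMem {a l t : ℝ} (hl : 0 ≤ l) (ht : t ∉ Ioo a (a + l)) :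
    cellBumpDeriv a l t = 0 := by simp [cellBumpDeriv, max_cell_of_notMem hl ht]

theorem integral_cellBump (a : ℝ) {l : ℝ} (hl : 0 < l) :
    ∫ t in a..(a + l), cellBump a l t = 1 := by
  have hd : ∀ t ∈ uIcc a (a + l), HasDerivAt
      (fun t => 30 / l ^ 5 * (l ^ 2 * (t - a) ^ 3 / 3 - l * (t - a) ^ 4 / 2 + (t - a) ^ 5 / 5))
      (cellBump a l t) t := by
    intro t ht
    rw [uIcc_of_le (by linarith)] at ht
    have h := (hasDerivAt_id t).sub_const a
    refine HasDerivAt.congr_deriv ((((((h.pow 3).const_mul (l ^ 2)).div_const 3).sub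
      (((h.pow 4).const_mul l).div_const 2)).add ((h.pow 5).div_const 5)).const_mul (30 / l ^ 5)) ?_
    simp only [cellBump, max_cell_of_mem ht, id]
    push_cast
    ring
  rw [intervalIntegral.integral_eq_sub_of_hasDerivAt hd
    ((continuous_cellBump a l).intervalIntegrable _ _)]
  field_simp
  ring

theorem integral_cellBump_sq (a : ℝ) {l : ℝ} (hl : 0 < l) :
    ∫ t in a..(a + l), cellBump a l t ^ 2 = 10 / (7 * l) := by
  have hd : ∀ t ∈ uIcc a (a + l), HasDerivAt
      (fun t => 900 / l ^ 10 * (l ^ 4 * (t - a) ^ 5 / 5 - 2 * l ^ 3 * (t - a) ^ 6 / 3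
        + 6 * l ^ 2 * (t - a) ^ 7 / 7 - l * (t - a) ^ 8 / 2 + (t - a) ^ 9 / 9))
      (cellBump a l t ^ 2) t := by
    intro t ht
    rw [uIcc_of_le (by linarith)] at ht
    have h := (hasDerivAt_id t).sub_const a
    refine HasDerivAt.congr_deriv ((((((((h.pow 5).const_mul (l ^ 4)).div_const 5).sub
      (((h.pow 6).const_mul (2 * l ^ 3)).div_const 3)).add
      (((h.pow 7).const_mul (6 * l ^ 2)).div_const 7)).sub
      (((h.pow 8).const_mul l).div_const 2)).add ((h.pow 9).div_const 9)).const_mul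
      (900 / l ^ 10)) ?_
    simp only [cellBump, max_cell_of_mem ht, id]
    push_cast
    field_simp
    ring
  rw [intervalIntegral.integral_eq_sub_of_hasDerivAt hd
    (((continuous_cellBump a l).pow 2).intervalIntegrable _ _)]
  field_simp
  ring

theorem integral_cellBumpDeriv_sq (a : ℝ) {l : ℝ} (hl : 0 < l) :
    ∫ t in a..(a + l), cellBumpDeriv a l t ^ 2 = 120 / (7 * l ^ 3) := by
  have hd : ∀ t ∈ uIcc a (a + l), HasDerivAt
      (fun t => 3600 / l ^ 10 * (l ^ 4 * (t - a) ^ 3 / 3 - 3 * l ^ 3 * (t - a) ^ 4 / 2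
        + 13 * l ^ 2 * (t - a) ^ 5 / 5 - 2 * l * (t - a) ^ 6 + 4 * (t - a) ^ 7 / 7))
      (cellBumpDeriv a l t ^ 2) t := by
    intro t ht
    rw [uIcc_of_le (by linarith)] at ht
    have h := (hasDerivAt_id t).sub_const a
    refine HasDerivAt.congr_deriv ((((((((h.pow 3).const_mul (l ^ 4)).div_const 3).sub
      (((h.pow 4).const_mul (3 * l ^ 3)).div_const 2)).add
      (((h.pow 5).const_mul (13 * l ^ 2)).div_const 5)).sub
      ((h.pow 6).const_mul (2 * l))).add (((h.pow 7).const_mul 4).div_const 7)).const_mul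
      (3600 / l ^ 10)) ?_
    simp only [cellBumpDeriv, max_cell_of_mem ht, id]
    push_cast
    field_simp
    ring
  rw [intervalIntegral.integral_eq_sub_of_hasDerivAt hd
    (((continuous_cellBumpDeriv a l).pow 2).intervalIntegrable _ _)]
  field_simp
  ring

theorem integral_sq_sub_cellBump_le (a : ℝ) {l : ℝ} (hl : 0 < l) {g : ℝ → ℝ}
    (hg : Continuous g) {c : ℝ} (hc : ∫ t in a..(a + l), g t = c) :
    ∫ t in a..(a + l), (g t - c * cellBump a l t) ^ 2
      ≤ 10 / 7 * ∫ t in a..(a + l), g t ^ 2 := by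
  have hB := continuous_cellBump a l
  have hab : a ≤ a + l := by linarith
  have h1 : ∫ t in a..(a + l), (g t - c / l) ^ 2
      = (∫ t in a..(a + l), g t ^ 2) - c ^ 2 / l := by
    have : ∀ t, (g t - c / l) ^ 2 = g t ^ 2 - (2 * (c / l)) * g t + (c / l) ^ 2 :=
      fun t => by ring
    simp_rw [this]
    rw [intervalIntegral.integral_add, intervalIntegral.integral_sub,
      intervalIntegral.integral_const_mul, intervalIntegral.integral_const, hc, smul_eq_mul]
    · field_simp
      ring
    all_goals exact Continuous.intervalIntegrable (by fun_prop) _ _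
  have h2 : ∫ t in a..(a + l), (c / l - c * cellBump a l t) ^ 2 = 3 / 7 * (c ^ 2 / l) := by
    have : ∀ t, (c / l - c * cellBump a l t) ^ 2
        = (c / l) ^ 2 - (2 * (c ^ 2 / l)) * cellBump a l t + c ^ 2 * cellBump a l t ^ 2 :=
      fun t => by ring
    simp_rw [this]
    rw [intervalIntegral.integral_add, intervalIntegral.integral_sub,
      intervalIntegral.integral_const_mul, intervalIntegral.integral_const_mul,
      intervalIntegral.integral_const, integral_cellBump a hl, integral_cellBump_sq a hl,
      smul_eq_mul]
    · field_simp
      ring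
    all_goals exact Continuous.intervalIntegrable (by fun_prop) _ _
  calc ∫ t in a..(a + l), (g t - c * cellBump a l t) ^ 2
      ≤ ∫ t in a..(a + l),
          (10 / 7 * (g t - c / l) ^ 2 + 10 / 3 * (c / l - c * cellBump a l t) ^ 2) := by
        refine intervalIntegral.integral_mono_on hab
          (Continuous.intervalIntegrable (by fun_prop) _ _)
          (Continuous.intervalIntegrable (by fun_prop) _ _) fun t _ => ?_
        nlinarith [sq_nonneg (3 / 7 * (g t - c / l) - (c / l - c * cellBump a l t))]
    _ = 10 / 7 * ∫ t in a..(a + l), g t ^ 2 := by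
        rw [intervalIntegral.integral_add, intervalIntegral.integral_const_mul,
          intervalIntegral.integral_const_mul, h1, h2]
        · ring
        all_goals exact Continuous.intervalIntegrable (by fun_prop) _ _

theorem cell_energy_le (a : ℝ) {l ω : ℝ} (hl : 0 < l) (h9 : 9 ≤ (ω * l) ^ 2)
    (hu : (ω * l) ^ 2 ≤ 81 / 4) {g : ℝ → ℝ} (hg : Continuous g) {c : ℝ}
    (hc : ∫ t in a..(a + l), g t = c) :
    ∫ t in a..(a + l), ((c / ω * cellBumpDeriv a l t) ^ 2 + ω ^ 2 * (c / ω * cellBump a l t) ^ 2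
        + (g t - c * cellBump a l t) ^ 2
        + ω ^ 2 * (∫ s in a..t, (g s - c * cellBump a l s)) ^ 2)
      ≤ 9 * ∫ t in a..(a + l), g t ^ 2 := by
  have hB := continuous_cellBump a l
  have hB' := continuous_cellBumpDeriv a l
  have hω : ω ≠ 0 := by rintro rfl; norm_num at h9
  have hab : a < a + l := by linarith
  have hf : Continuous fun t => g t - c * cellBump a l t := by fun_prop
  have hV : Continuous fun t => ∫ s in a..t, (g s - c * cellBump a l s) :=
    intervalIntegral.continuous_primitive (fun x y => hf.intervalIntegrable _ _) a
  have hf0 : ∫ t in a..(a + l), (g t - c * cellBump a l t) = 0 := by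
    rw [intervalIntegral.integral_sub (hg.intervalIntegrable _ _)
      (Continuous.intervalIntegrable (by fun_prop) _ _), intervalIntegral.integral_const_mul,
      hc, integral_cellBump a hl]
    ring
  have hF := integral_sq_sub_cellBump_le a hl hg hc
  have hP := integral_sq_primitive_le hab hf hf0
  have hc2 := sq_intervalIntegral_le hab.le hg
  rw [hc, add_sub_cancel_left] at hc2
  rw [add_sub_cancel_left] at hP
  simp_rw [mul_pow]
  rw [intervalIntegral.integral_add, intervalIntegral.integral_add, intervalIntegral.integral_add,
    intervalIntegral.integral_const_mul, intervalIntegral.integral_const_mul,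
    intervalIntegral.integral_const_mul, intervalIntegral.integral_const_mul,
    integral_cellBump_sq a hl, integral_cellBumpDeriv_sq a hl]
  · set A := ∫ t in a..(a + l), g t ^ 2
    set F := ∫ t in a..(a + l), (g t - c * cellBump a l t) ^ 2
    set P := ∫ t in a..(a + l), (∫ s in a..t, (g s - c * cellBump a l s)) ^ 2
    have hA : 0 ≤ A := by nlinarith [sq_nonneg c]
    set x := (ω * l) ^ 2 with hx
    have hx0 : 0 < x := by linarith
    have e1 : (c / ω) ^ 2 * (120 / (7 * l ^ 3)) ≤ 120 / (7 * x) * A := by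
      have : (c / ω) ^ 2 * (120 / (7 * l ^ 3)) = 120 / (7 * x) * (c ^ 2 / l) := by
        rw [hx]; field_simp
      rw [this]
      exact mul_le_mul_of_nonneg_left ((div_le_iff₀ hl).2 (by linarith)) (by positivity)
    have e2 : ω ^ 2 * ((c / ω) ^ 2 * (10 / (7 * l))) ≤ 10 / 7 * A := by
      have : ω ^ 2 * ((c / ω) ^ 2 * (10 / (7 * l))) = 10 / 7 * (c ^ 2 / l) := by
        field_simp
      rw [this]
      exact mul_le_mul_of_nonneg_left ((div_le_iff₀ hl).2 (by linarith)) (by positivity)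
    have e3 : ω ^ 2 * P ≤ x / 6 * (10 / 7 * A) := by
      calc ω ^ 2 * P ≤ ω ^ 2 * (l ^ 2 / 6 * F) := mul_le_mul_of_nonneg_left hP (sq_nonneg _)
        _ = x / 6 * F := by rw [hx]; ring
        _ ≤ _ := mul_le_mul_of_nonneg_left hF (by positivity)
    have e4 : 120 / (7 * x) + 10 / 7 + 10 / 7 + x / 6 * (10 / 7) ≤ 9 := by
      have : 120 / (7 * x) ≤ 9 - 20 / 7 - x * (10 / 42) := by
        rw [div_le_iff₀ (by positivity)]
        nlinarith
      linarith
    nlinarith [mul_le_mul_of_nonneg_right e4 hA]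
  all_goals exact Continuous.intervalIntegrable (by fun_prop) _ _

/-- One Fourier mode of a right inverse of the divergence on the strip `0 < y < H`, bounded
uniformly in the frequency `ω` and the height `H`. -/
theorem exists_real_mode (H ω : ℝ) (hH : 0 < H) (g : ℝ → ℝ) (hg : Continuous g)
    (h0 : ∫ t in (0 : ℝ)..H, g t = 0) :
    ∃ w w' v v' : ℝ → ℝ, (∀ t, HasDerivAt w (w' t) t) ∧ (∀ t, HasDerivAt v (v' t) t) ∧
      Continuous w' ∧ Continuous v' ∧ w 0 = 0 ∧ w H = 0 ∧ v 0 = 0 ∧ v H = 0 ∧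
      (∀ t, ω * w t + v' t = g t) ∧
      ∫ t in (0 : ℝ)..H, (w' t ^ 2 + ω ^ 2 * w t ^ 2 + v' t ^ 2 + ω ^ 2 * v t ^ 2)
        ≤ 9 * ∫ t in (0 : ℝ)..H, g t ^ 2 := by
  by_cases hsmall : |ω| * H ≤ 6
  · refine ⟨fun _ => 0, fun _ => 0, fun t => ∫ s in (0 : ℝ)..t, g s, g,
      fun t => hasDerivAt_const _ _, fun t => hg.integral_hasStrictDerivAt 0 t |>.hasDerivAt,
      continuous_const, hg, rfl, rfl, by simp, h0, fun t => by simp, ?_⟩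
    have hV : Continuous fun t => ∫ s in (0 : ℝ)..t, g s :=
      intervalIntegral.continuous_primitive (fun x y => hg.intervalIntegrable _ _) 0
    have hP := integral_sq_primitive_le hH hg h0
    simp only [ne_eq, OfNat.ofNat_ne_zero, not_false_eq_true, zero_pow, mul_zero, add_zero,
      zero_add]
    rw [intervalIntegral.integral_add (Continuous.intervalIntegrable (by fun_prop) _ _)
      (Continuous.intervalIntegrable (by fun_prop) _ _), intervalIntegral.integral_const_mul]
    have hA : 0 ≤ ∫ t in (0 : ℝ)..H, g t ^ 2 :=
      intervalIntegral.integral_nonneg hH.le fun t _ => sq_nonneg _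
    have hx : ω ^ 2 * H ^ 2 ≤ 36 := by
      have : ω ^ 2 * H ^ 2 = (|ω| * H) ^ 2 := by rw [mul_pow, sq_abs]
      rw [this]
      have : 0 ≤ |ω| * H := by positivity
      nlinarith
    rw [sub_zero] at hP
    have := mul_le_mul_of_nonneg_left hP (sq_nonneg ω)
    nlinarith [mul_le_mul_of_nonneg_right hx hA]
  push Not at hsmall
  set n := ⌊|ω| * H / 3⌋₊ with hn
  have hn2 : 2 ≤ n := Nat.le_floor (by push_cast; linarith)
  have hn2' : (2 : ℝ) ≤ n := by exact_mod_cast hn2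
  have hn0 : (0 : ℝ) < n := by linarith
  have hnle : (n : ℝ) ≤ |ω| * H / 3 := Nat.floor_le (by positivity)
  have hnlt : |ω| * H / 3 < n + 1 := Nat.lt_floor_add_one _
  set l := H / n with hl
  have hl0 : 0 < l := by positivity
  have hnl : n * l = H := by rw [hl]; field_simp
  have hω : ω ≠ 0 := by rintro rfl; norm_num at hsmall
  have habs : (ω * l) ^ 2 = (|ω| * l) ^ 2 := by rw [mul_pow, mul_pow, sq_abs]
  have hlow : 3 ≤ |ω| * l := by
    rw [hl, mul_div_assoc', le_div_iff₀ hn0]; linarith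
  have hupp : |ω| * l ≤ 9 / 2 := by
    rw [hl, mul_div_assoc', div_le_iff₀ hn0]; linarith
  have h9 : 9 ≤ (ω * l) ^ 2 := by rw [habs]; nlinarith
  have hu : (ω * l) ^ 2 ≤ 81 / 4 := by rw [habs]; nlinarith
  set p : ℕ → ℝ := fun j => j * l with hp
  have hp1 : ∀ j, p (j + 1) = p j + l := fun j => by simp only [hp]; push_cast; ring
  set c : ℕ → ℝ := fun j => ∫ t in p j..(p j + l), g t with hcdef
  set w : ℝ → ℝ := fun t => ∑ j ∈ Finset.range n, c j / ω * cellBump (p j) l t with hw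
  set w' : ℝ → ℝ := fun t => ∑ j ∈ Finset.range n, c j / ω * cellBumpDeriv (p j) l t with hw'
  have hcB := fun a => continuous_cellBump a l
  have hcB' := fun a => continuous_cellBumpDeriv a l
  have hwc : Continuous w := by fun_prop
  have hwc' : Continuous w' := by fun_prop
  set f : ℝ → ℝ := fun t => g t - ω * w t with hf
  have hfc : Continuous f := by fun_prop
  set v : ℝ → ℝ := fun t => ∫ s in (0 : ℝ)..t, f s with hv
  have hvc : Continuous v :=
    intervalIntegral.continuous_primitive (fun x y => hfc.intervalIntegrable _ _) 0
  have hdisj : ∀ i j, i ≠ j → ∀ t ∈ Icc (p j) (p j + l), t ∉ Ioo (p i) (p i + l) := by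
    intro i j hij t ht hti
    rcases lt_or_gt_of_ne hij with h | h
    · have : (i : ℝ) + 1 ≤ j := by exact_mod_cast h
      have := mul_le_mul_of_nonneg_right this hl0.le
      simp only [hp, mem_Icc, mem_Ioo] at ht hti
      linarith [ht.1, hti.2]
    · have : (j : ℝ) + 1 ≤ i := by exact_mod_cast h
      have := mul_le_mul_of_nonneg_right this hl0.le
      simp only [hp, mem_Icc, mem_Ioo] at ht hti
      linarith [ht.2, hti.1]
  have hwcell : ∀ j < n, ∀ t ∈ Icc (p j) (p j + l), w t = c j / ω * cellBump (p j) l t := by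
    intro j hj t ht
    refine Finset.sum_eq_single j (fun i _ hij => ?_) (fun h => absurd (Finset.mem_range.2 hj) h)
    rw [cellBump_of_notMem hl0.le (hdisj i j hij t ht), mul_zero]
  have hwcell' : ∀ j < n, ∀ t ∈ Icc (p j) (p j + l),
      w' t = c j / ω * cellBumpDeriv (p j) l t := by
    intro j hj t ht
    refine Finset.sum_eq_single j (fun i _ hij => ?_) (fun h => absurd (Finset.mem_range.2 hj) h)
    rw [cellBumpDeriv_of_notMem hl0.le (hdisj i j hij t ht), mul_zero]
  have hfcell : ∀ j < n, ∀ t ∈ Icc (p j) (p j + l), f t = g t - c j * cellBump (p j) l t := by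
    intro j hj t ht
    simp only [hf, hwcell j hj t ht]
    field_simp
  have hvp : ∀ j ≤ n, v (p j) = 0 := by
    intro j
    induction j with
    | zero => intro _; simp [hv, hp]
    | succ j ih =>
      intro hj
      have hj' : j < n := hj
      have := intervalIntegral.integral_add_adjacent_intervals
        (hfc.intervalIntegrable (μ := volume) 0 (p j)) (hfc.intervalIntegrable (p j) (p j + l))
      rw [hp1]
      change ∫ s in (0 : ℝ)..(p j + l), f s = 0
      rw [← this]
      change v (p j) + _ = 0
      rw [ih hj'.le, zero_add, intervalIntegral.integral_congr (g := fun t =>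
        g t - c j * cellBump (p j) l t) (fun t ht => hfcell j hj' t (by
          rwa [uIcc_of_le (by linarith)] at ht)),
        intervalIntegral.integral_sub (hg.intervalIntegrable _ _)
        (Continuous.intervalIntegrable (by fun_prop) _ _), intervalIntegral.integral_const_mul,
        integral_cellBump _ hl0]
      simp [hcdef]
  have hvcell : ∀ j < n, ∀ t ∈ Icc (p j) (p j + l),
      v t = ∫ s in (p j)..t, (g s - c j * cellBump (p j) l s) := by
    intro j hj t ht
    have h1 := intervalIntegral.integral_add_adjacent_intervals
      (hfc.intervalIntegrable (μ := volume) 0 (p j)) (hfc.intervalIntegrable (p j) t)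
    have h2 : ∫ s in (0 : ℝ)..p j, f s = 0 := hvp j hj.le
    rw [h2, zero_add] at h1
    change ∫ s in (0 : ℝ)..t, f s = _
    rw [← h1]
    refine intervalIntegral.integral_congr fun s hs => hfcell j hj s ?_
    rw [uIcc_of_le ht.1] at hs
    exact ⟨hs.1, hs.2.trans ht.2⟩
  have hpn : p n = H := hnl
  have hp0 : p 0 = 0 := by simp [hp]
  refine ⟨w, w', v, f, fun t => ?_, fun t => hfc.integral_hasStrictDerivAt 0 t |>.hasDerivAt,
    hwc', hfc, ?_, ?_, by simp [hv], ?_, fun t => by simp [hf], ?_⟩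
  · exact HasDerivAt.fun_sum fun j _ => (hasDerivAt_cellBump (p j) l t).const_mul (c j / ω)
  · refine Finset.sum_eq_zero fun j _ => ?_
    rw [cellBump_of_notMem hl0.le, mul_zero]
    intro h
    have : 0 ≤ p j := by positivity
    linarith [h.1]
  · refine Finset.sum_eq_zero fun j hj => ?_
    rw [cellBump_of_notMem hl0.le, mul_zero]
    intro h
    have : (j : ℝ) + 1 ≤ n := by exact_mod_cast Finset.mem_range.1 hj
    have := mul_le_mul_of_nonneg_right this hl0.le
    simp only [hp, mem_Ioo] at h
    linarith [h.2]
  · rw [← hpn]; exact hvp n le_rfl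
  · rw [← hpn, ← hp0, ← intervalIntegral.sum_integral_adjacent_intervals
      (fun k _ => Continuous.intervalIntegrable (by fun_prop) _ _),
      ← intervalIntegral.sum_integral_adjacent_intervals
      (fun k _ => Continuous.intervalIntegrable (by fun_prop) _ _), Finset.mul_sum]
    refine Finset.sum_le_sum fun j hj => ?_
    have hj' := Finset.mem_range.1 hj
    rw [hp1]
    refine le_trans (le_of_eq ?_) (cell_energy_le (p j) hl0 h9 hu hg rfl)
    refine intervalIntegral.integral_congr fun t ht => ?_
    rw [uIcc_of_le (by linarith)] at ht
    simp only [hwcell j hj' t ht, hwcell' j hj' t ht, hfcell j hj' t ht, hvcell j hj' t ht,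
      hcdef]

theorem exists_complex_mode (H ω : ℝ) (hH : 0 < H) (g : ℝ → ℂ) (hg : Continuous g)
    (h0 : ∫ t in (0 : ℝ)..H, g t = 0) :
    ∃ a a' b b' : ℝ → ℂ, (∀ t, HasDerivAt a (a' t) t) ∧ (∀ t, HasDerivAt b (b' t) t) ∧
      Continuous a' ∧ Continuous b' ∧ a 0 = 0 ∧ a H = 0 ∧ b 0 = 0 ∧ b H = 0 ∧
      (∀ t, ω * Complex.I * a t + b' t = g t) ∧
      ∫ t in (0 : ℝ)..H, (‖ω * Complex.I * a t‖ ^ 2 + ‖a' t‖ ^ 2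
          + (‖ω * Complex.I * b t‖ ^ 2 + ‖b' t‖ ^ 2))
        ≤ 9 * ∫ t in (0 : ℝ)..H, ‖g t‖ ^ 2 := by
  have hgi : IntervalIntegrable g volume 0 H := hg.intervalIntegrable _ _
  have hre : Continuous fun t => (g t).re := Complex.continuous_re.comp hg
  have him : Continuous fun t => (g t).im := Complex.continuous_im.comp hg
  have hre0 : ∫ t in (0 : ℝ)..H, (g t).re = 0 := by
    have := Complex.reCLM.intervalIntegral_comp_comm hgi
    simpa [h0] using this
  have him0 : ∫ t in (0 : ℝ)..H, (g t).im = 0 := by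
    have := Complex.imCLM.intervalIntegral_comp_comm hgi
    simpa [h0] using this
  obtain ⟨w, w', v, v', hw, hv, hwc, hvc, hw0, hwH, hv0, hvH, hdiv, hE⟩ :=
    exists_real_mode H ω hH _ hre hre0
  obtain ⟨z, z', y, y', hz, hy, hzc, hyc, hz0, hzH, hy0, hyH, hdiv2, hE2⟩ :=
    exists_real_mode H ω hH _ him him0
  have cont : ∀ {f f' : ℝ → ℝ}, (∀ t, HasDerivAt f (f' t) t) → Continuous f := fun h =>
    continuous_iff_continuousAt.2 fun t => (h t).continuousAt
  have c1 := cont hw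
  have c2 := cont hv
  have c3 := cont hz
  have c4 := cont hy
  refine ⟨fun t => z t - Complex.I * w t, fun t => z' t - Complex.I * w' t,
    fun t => v t + Complex.I * y t, fun t => v' t + Complex.I * y' t,
    fun t => (hz t).ofReal_comp.sub ((hw t).ofReal_comp.const_mul _),
    fun t => (hv t).ofReal_comp.add ((hy t).ofReal_comp.const_mul _), by fun_prop, by fun_prop,
    by simp [hz0, hw0], by simp [hzH, hwH], by simp [hv0, hy0], by simp [hvH, hyH], ?_, ?_⟩
  · intro t
    apply Complex.ext
    · simp [← hdiv t]
    · simp [← hdiv2 t]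
  · have e1 : ∀ t, ‖g t‖ ^ 2 = (g t).re ^ 2 + (g t).im ^ 2 := fun t => by
      rw [← Complex.normSq_eq_norm_sq, Complex.normSq_apply]; ring
    have e2 : ∀ t, ‖ω * Complex.I * (z t - Complex.I * w t)‖ ^ 2
          + ‖(z' t : ℂ) - Complex.I * w' t‖ ^ 2
          + (‖ω * Complex.I * (v t + Complex.I * y t)‖ ^ 2
          + ‖(v' t : ℂ) + Complex.I * y' t‖ ^ 2)
        = (w' t ^ 2 + ω ^ 2 * w t ^ 2 + v' t ^ 2 + ω ^ 2 * v t ^ 2)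
          + (z' t ^ 2 + ω ^ 2 * z t ^ 2 + y' t ^ 2 + ω ^ 2 * y t ^ 2) := fun t => by
      simp only [← Complex.normSq_eq_norm_sq, Complex.normSq_apply]
      simp
      ring
    simp_rw [e1, e2]
    have h := add_le_add hE hE2
    rwa [← mul_add, ← intervalIntegral.integral_add, ← intervalIntegral.integral_add] at h
    all_goals exact Continuous.intervalIntegrable (by fun_prop) _ _

/-- The frequency of the `k`-th `L`-periodic mode. -/
noncomputable def xFreq (L : ℝ) (k : ℤ) : ℝ := 2 * Real.pi * k / L

/-- The `k`-th `L`-periodic mode. -/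
noncomputable def xMode (L : ℝ) (k : ℤ) (x : ℝ) : ℂ := Complex.exp (xFreq L k * Complex.I * x)

theorem hasDerivAt_xMode (L : ℝ) (k : ℤ) (x : ℝ) :
    HasDerivAt (xMode L k) (xFreq L k * Complex.I * xMode L k x) x := by
  have h : HasDerivAt (fun x : ℝ => (xFreq L k * Complex.I * x : ℂ)) (xFreq L k * Complex.I) x := by
    simpa using (hasDerivAt_id x).ofReal_comp.const_mul (xFreq L k * Complex.I : ℂ)
  exact h.cexp.congr_deriv (by rw [xMode]; ring)

theorem contDiff_xMode (L : ℝ) (k : ℤ) : ContDiff ℝ 1 (xMode L k) := by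
  unfold xMode
  exact (contDiff_const.mul Complex.ofRealCLM.contDiff).cexp

theorem continuous_xMode (L : ℝ) (k : ℤ) : Continuous (xMode L k) := (contDiff_xMode L k).continuous

theorem norm_xMode (L : ℝ) (k : ℤ) (x : ℝ) : ‖xMode L k x‖ = 1 := by
  rw [xMode, show (xFreq L k * Complex.I * x : ℂ) = ((xFreq L k * x : ℝ) : ℂ) * Complex.I by
    push_cast; ring, Complex.norm_exp_ofReal_mul_I]

theorem xMode_add_period {L : ℝ} (hL : L ≠ 0) (k : ℤ) (x : ℝ) :
    xMode L k (x + L) = xMode L k x := by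
  have hL' : (L : ℂ) ≠ 0 := by exact_mod_cast hL
  rw [xMode, xMode, Complex.exp_eq_exp_iff_exists_int]
  refine ⟨k, ?_⟩
  simp only [xFreq]
  push_cast
  field_simp

theorem star_xMode_mul (L : ℝ) (j k : ℤ) (x : ℝ) :
    star (xMode L j x) * xMode L k x = xMode L (k - j) x := by
  have h : xFreq L (k - j) = xFreq L k - xFreq L j := by
    unfold xFreq
    push_cast
    ring
  simp only [xMode, h, Complex.star_def, ← Complex.exp_conj, ← Complex.exp_add]
  congr 1
  simp
  ring

theorem integral_xMode {L : ℝ} (hL : L ≠ 0) {k : ℤ} (hk : k ≠ 0) :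
    ∫ x in (0 : ℝ)..L, xMode L k x = 0 := by
  have hc : (xFreq L k * Complex.I : ℂ) ≠ 0 := by
    refine mul_ne_zero ?_ Complex.I_ne_zero
    have : xFreq L k ≠ 0 := by
      unfold xFreq
      have : (k : ℝ) ≠ 0 := by exact_mod_cast hk
      have := Real.pi_ne_zero
      positivity
    exact_mod_cast this
  have h := xMode_add_period hL k 0
  simp only [xMode, zero_add] at h ⊢
  rw [integral_exp_mul_complex hc, h, sub_self, zero_div]

theorem integral_star_xMode_mul {L : ℝ} (hL : L ≠ 0) (j k : ℤ) :
    ∫ x in (0 : ℝ)..L, star (xMode L j x) * xMode L k x = if j = k then (L : ℂ) else 0 := by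
  simp_rw [star_xMode_mul]
  split_ifs with h
  · simp [h, xMode, xFreq]
  · exact integral_xMode hL (sub_ne_zero.2 (Ne.symm h))

/-- The Fourier coefficients on `(0, L)`. -/
noncomputable def xCoeff (L : ℝ) (F : ℝ → ℂ) (k : ℤ) : ℂ :=
  (1 / L : ℝ) * ∫ x in (0 : ℝ)..L, star (xMode L k x) * F x

theorem intervalIntegrable_star_xMode_mul {L : ℝ} {F : ℝ → ℂ} (k : ℤ)
    (hF : IntervalIntegrable F volume 0 L) :
    IntervalIntegrable (fun x => star (xMode L k x) * F x) volume 0 L :=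
  hF.continuousOn_mul (continuous_star.comp (continuous_xMode L k)).continuousOn

theorem xCoeff_sub_mode {L : ℝ} (hL : L ≠ 0) {F : ℝ → ℂ} (hF : IntervalIntegrable F volume 0 L)
    (d : ℂ) (k j : ℤ) :
    xCoeff L (fun x => F x - d * xMode L k x) j = xCoeff L F j - if j = k then d else 0 := by
  have hm := continuous_xMode L
  have e : ∀ x, star (xMode L j x) * (F x - d * xMode L k x)
      = star (xMode L j x) * F x - d * (star (xMode L j x) * xMode L k x) := fun x => by ring
  simp only [xCoeff, e]
  rw [intervalIntegral.integral_sub (intervalIntegrable_star_xMode_mul j hF)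
    (Continuous.intervalIntegrable (by fun_prop) _ _), intervalIntegral.integral_const_mul,
    integral_star_xMode_mul hL]
  have hL' : (L : ℂ) ≠ 0 := by exact_mod_cast hL
  split_ifs
  · push_cast
    field_simp
  · simp

theorem norm_sq_sub_mode (L : ℝ) (z d : ℂ) (k : ℤ) (x : ℝ) :
    ‖z - d * xMode L k x‖ ^ 2
      = ‖z‖ ^ 2 - 2 * (star d * (star (xMode L k x) * z)).re + ‖d‖ ^ 2 := by
  have h1 : ‖d * xMode L k x‖ ^ 2 = ‖d‖ ^ 2 := by rw [norm_mul, norm_xMode, mul_one]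
  rw [← h1]
  simp only [← Complex.normSq_eq_norm_sq, Complex.normSq_apply]
  simp
  ring

theorem integral_norm_sq_sub_sum {L : ℝ} (hL : L ≠ 0) (d : ℤ → ℂ) (S : Finset ℤ) :
    ∀ F : ℝ → ℂ, IntervalIntegrable F volume 0 L →
      IntervalIntegrable (fun x => ‖F x‖ ^ 2) volume 0 L →
      ∫ x in (0 : ℝ)..L, ‖F x - ∑ k ∈ S, d k * xMode L k x‖ ^ 2
        = (∫ x in (0 : ℝ)..L, ‖F x‖ ^ 2)
          + L * ∑ k ∈ S, (‖d k‖ ^ 2 - 2 * (star (d k) * xCoeff L F k).re) := by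
  induction S using Finset.induction_on with
  | empty => intro F _ _; simp
  | insert k S hk ih =>
    intro F hF hF2
    have hm := continuous_xMode L
    have hI := ((intervalIntegrable_star_xMode_mul k hF).const_mul (star (d k)))
    have hre : IntervalIntegrable
        (fun x => (star (d k) * (star (xMode L k x) * F x)).re) volume 0 L :=
      ⟨hI.1.re, hI.2.re⟩
    have hF' : IntervalIntegrable (fun x => F x - d k * xMode L k x) volume 0 L :=
      hF.sub (Continuous.intervalIntegrable (by fun_prop) _ _)
    have hF2' : IntervalIntegrable (fun x => ‖F x - d k * xMode L k x‖ ^ 2) volume 0 L := by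
      simp_rw [norm_sq_sub_mode]
      exact (hF2.sub (hre.const_mul 2)).add intervalIntegrable_const
    have h1 : ∫ x in (0 : ℝ)..L, ‖F x - d k * xMode L k x‖ ^ 2
        = (∫ x in (0 : ℝ)..L, ‖F x‖ ^ 2)
          + L * (‖d k‖ ^ 2 - 2 * (star (d k) * xCoeff L F k).re) := by
      simp_rw [norm_sq_sub_mode]
      rw [intervalIntegral.integral_add (hF2.sub (hre.const_mul 2)) intervalIntegrable_const,
        intervalIntegral.integral_sub hF2 (hre.const_mul 2), intervalIntegral.integral_const_mul,
        intervalIntegral.integral_const]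
      have h2 : ∫ x in (0 : ℝ)..L, (star (d k) * (star (xMode L k x) * F x)).re
          = L * (star (d k) * xCoeff L F k).re := by
        have := Complex.reCLM.intervalIntegral_comp_comm hI
        simp only [Complex.reCLM_apply] at this
        rw [this, intervalIntegral.integral_const_mul, ← Complex.re_ofReal_mul, xCoeff]
        congr 1
        have hL' : (L : ℂ) ≠ 0 := by exact_mod_cast hL
        push_cast
        field_simp
      rw [h2, smul_eq_mul]
      ring
    have h3 : ∀ x, F x - ∑ j ∈ insert k S, d j * xMode L j x
        = (F x - d k * xMode L k x) - ∑ j ∈ S, d j * xMode L j x := fun x => by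
      rw [Finset.sum_insert hk]; ring
    simp_rw [h3]
    rw [ih _ hF' hF2', h1, Finset.sum_insert hk]
    have h4 : ∀ j ∈ S, xCoeff L (fun x => F x - d k * xMode L k x) j = xCoeff L F j := by
      intro j hj
      rw [xCoeff_sub_mode hL hF, if_neg (ne_of_mem_of_not_mem hj hk), sub_zero]
    rw [Finset.sum_congr rfl fun j hj => by rw [h4 j hj]]
    ring

theorem integral_norm_sq_sum {L : ℝ} (hL : L ≠ 0) (d : ℤ → ℂ) (S : Finset ℤ) :
    ∫ x in (0 : ℝ)..L, ‖∑ k ∈ S, d k * xMode L k x‖ ^ 2 = L * ∑ k ∈ S, ‖d k‖ ^ 2 := by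
  have h := integral_norm_sq_sub_sum hL d S (fun _ => 0) intervalIntegrable_const
    intervalIntegrable_const
  simpa [xCoeff] using h

theorem integral_norm_sq_sub_partialSum {L : ℝ} (hL : L ≠ 0) (S : Finset ℤ) {F : ℝ → ℂ}
    (hF : IntervalIntegrable F volume 0 L)
    (hF2 : IntervalIntegrable (fun x => ‖F x‖ ^ 2) volume 0 L) :
    ∫ x in (0 : ℝ)..L, ‖F x - ∑ k ∈ S, xCoeff L F k * xMode L k x‖ ^ 2
      = (∫ x in (0 : ℝ)..L, ‖F x‖ ^ 2) - L * ∑ k ∈ S, ‖xCoeff L F k‖ ^ 2 := by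
  rw [integral_norm_sq_sub_sum hL _ S F hF hF2, sub_eq_add_neg, ← mul_neg,
    ← Finset.sum_neg_distrib]
  congr 2
  refine Finset.sum_congr rfl fun k _ => ?_
  rw [Complex.star_def, ← Complex.normSq_eq_conj_mul_self, Complex.ofReal_re,
    Complex.normSq_eq_norm_sq]
  ring

theorem hasSum_norm_sq_xCoeff {L : ℝ} (hL : 0 < L) {F : ℝ → ℂ}
    (hF : MemLp F 2 (volume.restrict (Ioc 0 L))) :
    HasSum (fun k => L * ‖xCoeff L F k‖ ^ 2) (∫ x in (0 : ℝ)..L, ‖F x‖ ^ 2) := by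
  have h := (hasSum_sq_fourierCoeffOn hL hF).mul_left L
  have e : ∀ k, fourierCoeffOn hL F k = xCoeff L F k := by
    intro k
    rw [fourierCoeffOn_eq_integral, xCoeff, Complex.real_smul, sub_zero]
    congr 1
    refine intervalIntegral.integral_congr fun x _ => ?_
    have hx : fourier (-k) (x : AddCircle L) = star (xMode L k x) := by
      rw [fourier_neg, fourier_coe_apply, xMode, Complex.star_def, xFreq]
      congr 2
      push_cast
      ring
    simp only [hx, smul_eq_mul]
  have hI : L * (L - 0)⁻¹ • ∫ x in (0 : ℝ)..L, ‖F x‖ ^ 2 = ∫ x in (0 : ℝ)..L, ‖F x‖ ^ 2 := by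
    rw [sub_zero, smul_eq_mul]
    field_simp
  simpa only [e, hI] using h

theorem isFiniteMeasure_restrict_RectR (L H : ℝ) :
    IsFiniteMeasure (volume.restrict (RectR L H)) := by
  refine ⟨?_⟩
  rw [Measure.restrict_apply_univ, RectR, Measure.volume_eq_prod, Measure.prod_prod]
  simp [ENNReal.mul_lt_top]

theorem setIntegral_RectR {L H : ℝ} (hL : 0 ≤ L) (hH : 0 ≤ H) {Φ : ℝ × ℝ → ℝ}
    (hΦ : IntegrableOn Φ (RectR L H)) :
    ∫ p in RectR L H, Φ p = ∫ y in (0 : ℝ)..H, ∫ x in (0 : ℝ)..L, Φ (x, y) := by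
  rw [IntegrableOn, RectR, Measure.volume_eq_prod, ← Measure.prod_restrict] at hΦ
  rw [RectR, Measure.volume_eq_prod, ← Measure.prod_restrict, integral_prod_symm _ hΦ,
    intervalIntegral.integral_of_le hH, integral_Ioc_eq_integral_Ioo]
  simp_rw [intervalIntegral.integral_of_le hL, integral_Ioc_eq_integral_Ioo]

theorem Continuous.integrableOn_RectR {L H : ℝ} {E : Type*} [NormedAddCommGroup E]
    {Φ : ℝ × ℝ → E} (hΦ : Continuous Φ) : IntegrableOn Φ (RectR L H) := by
  refine (hΦ.continuousOn.integrableOn_compact (isCompact_Icc.prod isCompact_Icc)).mono_set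
    (prod_mono (Ioo_subset_Icc_self (a := (0 : ℝ)) (b := L))
      (Ioo_subset_Icc_self (a := (0 : ℝ)) (b := H)))

/-- A finite sum of `L`-periodic modes in `x` with coefficients depending on `y`. -/
noncomputable def modeSum (L : ℝ) (S : Finset ℤ) (a : ℤ → ℝ → ℂ) (p : ℝ × ℝ) : ℂ :=
  ∑ k ∈ S, a k p.2 * xMode L k p.1

theorem continuous_modeSum (L : ℝ) (S : Finset ℤ) {a : ℤ → ℝ → ℂ} (ha : ∀ k, Continuous (a k)) :
    Continuous (modeSum L S a) := by
  have := continuous_xMode L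
  unfold modeSum
  fun_prop

theorem integral_norm_sq_modeSum {L H : ℝ} (hL : 0 < L) (hH : 0 < H) (S : Finset ℤ)
    {a : ℤ → ℝ → ℂ} (ha : ∀ k, Continuous (a k)) :
    ∫ p in RectR L H, ‖modeSum L S a p‖ ^ 2
      = L * ∑ k ∈ S, ∫ y in (0 : ℝ)..H, ‖a k y‖ ^ 2 := by
  have hc := continuous_modeSum L S ha
  rw [setIntegral_RectR hL.le hH.le (Continuous.integrableOn_RectR (by fun_prop))]
  simp only [modeSum]
  simp_rw [integral_norm_sq_sum hL.ne']
  rw [intervalIntegral.integral_const_mul, intervalIntegral.integral_finsetSum]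
  exact fun k _ => Continuous.intervalIntegrable (by fun_prop) _ _

theorem contDiff_re_modeSum (L : ℝ) (S : Finset ℤ) {a a' : ℤ → ℝ → ℂ}
    (ha : ∀ k t, HasDerivAt (a k) (a' k t) t) (ha' : ∀ k, Continuous (a' k)) :
    ContDiff ℝ 1 fun p => (modeSum L S a p).re := by
  have h1 : ∀ k, ContDiff ℝ 1 (a k) := fun k => by
    rw [contDiff_one_iff_deriv]
    refine ⟨fun t => (ha k t).differentiableAt, ?_⟩
    rw [funext fun t => (ha k t).deriv]
    exact ha' k
  refine Complex.reCLM.contDiff.comp (ContDiff.sum fun k _ => ?_)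
  exact ((h1 k).comp contDiff_snd).mul ((contDiff_xMode L k).comp contDiff_fst)

theorem fderiv_re_modeSum_fst (L : ℝ) (S : Finset ℤ) {a a' : ℤ → ℝ → ℂ}
    (ha : ∀ k t, HasDerivAt (a k) (a' k t) t) (ha' : ∀ k, Continuous (a' k)) (p : ℝ × ℝ) :
    fderiv ℝ (fun p => (modeSum L S a p).re) p (1, 0)
      = (modeSum L S (fun k t => xFreq L k * Complex.I * a k t) p).re := by
  have hd := ((contDiff_re_modeSum L S ha ha').differentiable one_ne_zero p).hasFDerivAt
  have hl : HasDerivAt (fun x : ℝ => (x, p.2)) ((1 : ℝ), (0 : ℝ)) p.1 :=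
    (hasDerivAt_id p.1).prodMk (hasDerivAt_const _ _)
  have h1 := HasFDerivAt.comp_hasDerivAt p.1 (f := fun x : ℝ => (x, p.2)) hd hl
  have h2 : HasDerivAt (fun x : ℝ => modeSum L S a (x, p.2))
      (modeSum L S (fun k t => xFreq L k * Complex.I * a k t) p) p.1 := by
    refine (HasDerivAt.fun_sum fun k _ =>
      (hasDerivAt_xMode L k p.1).const_mul (a k p.2)).congr_deriv ?_
    exact Finset.sum_congr rfl fun k _ => by ring
  exact h1.unique ((Complex.reCLM.hasFDerivAt).comp_hasDerivAt p.1 h2)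

theorem fderiv_re_modeSum_snd (L : ℝ) (S : Finset ℤ) {a a' : ℤ → ℝ → ℂ}
    (ha : ∀ k t, HasDerivAt (a k) (a' k t) t) (ha' : ∀ k, Continuous (a' k)) (p : ℝ × ℝ) :
    fderiv ℝ (fun p => (modeSum L S a p).re) p (0, 1) = (modeSum L S a' p).re := by
  have hd := ((contDiff_re_modeSum L S ha ha').differentiable one_ne_zero p).hasFDerivAt
  have hl : HasDerivAt (fun y : ℝ => (p.1, y)) ((0 : ℝ), (1 : ℝ)) p.2 :=
    (hasDerivAt_const _ _).prodMk (hasDerivAt_id p.2)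
  have h1 := HasFDerivAt.comp_hasDerivAt p.2 (f := fun y : ℝ => (p.1, y)) hd hl
  have h2 : HasDerivAt (fun y : ℝ => modeSum L S a (p.1, y)) (modeSum L S a' p) p.2 :=
    HasDerivAt.fun_sum fun k _ => (ha k p.2).mul_const (xMode L k p.1)
  exact h1.unique ((Complex.reCLM.hasFDerivAt).comp_hasDerivAt p.2 h2)

theorem admRect_re_modeSum {L H : ℝ} (hL : 0 < L) (S : Finset ℤ) {a a' : ℤ → ℝ → ℂ}
    (ha : ∀ k t, HasDerivAt (a k) (a' k t) t) (ha' : ∀ k, Continuous (a' k))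
    (h0 : ∀ k, a k 0 = 0) (hH : ∀ k, a k H = 0) :
    AdmRect L H fun p => (modeSum L S a p).re := by
  refine ⟨contDiff_re_modeSum L S ha ha', fun x y => ?_, fun x => ?_, fun x => ?_⟩
  · simp only [modeSum, xMode_add_period hL.ne']
  · simp [modeSum, h0]
  · simp [modeSum, hH]

theorem energyRect_re_modeSum_le {L H : ℝ} (hL : 0 < L) (hH : 0 < H) (S : Finset ℤ)
    {a a' : ℤ → ℝ → ℂ} (ha : ∀ k t, HasDerivAt (a k) (a' k t) t)
    (ha' : ∀ k, Continuous (a' k)) :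
    energyRect L H (fun p => (modeSum L S a p).re)
      ≤ L * ∑ k ∈ S, ∫ y in (0 : ℝ)..H, (‖xFreq L k * Complex.I * a k y‖ ^ 2 + ‖a' k y‖ ^ 2) := by
  have hac : ∀ k, Continuous (a k) := fun k =>
    continuous_iff_continuousAt.2 fun t => (ha k t).continuousAt
  have hac2 : ∀ k, Continuous fun t => xFreq L k * Complex.I * a k t := fun k => by fun_prop
  have c1 := continuous_modeSum L S hac2
  have c2 := continuous_modeSum L S ha'
  simp only [energyRect, fderiv_re_modeSum_fst L S ha ha', fderiv_re_modeSum_snd L S ha ha']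
  have hsq : ∀ z : ℂ, z.re ^ 2 ≤ ‖z‖ ^ 2 := fun z => by
    rw [← Complex.normSq_eq_norm_sq, Complex.normSq_apply]
    nlinarith [sq_nonneg z.im]
  have hre := Complex.continuous_re
  calc _ ≤ ∫ p in RectR L H,
        (‖modeSum L S (fun k t => xFreq L k * Complex.I * a k t) p‖ ^ 2
          + ‖modeSum L S a' p‖ ^ 2) :=
        integral_mono (μ := volume.restrict (RectR L H))
          (Continuous.integrableOn_RectR (((hre.comp c1).pow 2).add ((hre.comp c2).pow 2)))
          (Continuous.integrableOn_RectR (by fun_prop))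
          fun p => add_le_add (hsq _) (hsq _)
    _ = _ := by
        rw [integral_add (μ := volume.restrict (RectR L H))
          (Continuous.integrableOn_RectR (by fun_prop))
          (Continuous.integrableOn_RectR (by fun_prop)),
          integral_norm_sq_modeSum hL hH S hac2, integral_norm_sq_modeSum hL hH S ha',
          ← mul_add, ← Finset.sum_add_distrib]
        congr 1
        refine Finset.sum_congr rfl fun k _ => (intervalIntegral.integral_add ?_ ?_).symm
        all_goals exact Continuous.intervalIntegrable (by fun_prop) _ _

theorem energyRect_nonneg (L H : ℝ) (u : ℝ × ℝ → ℝ) : 0 ≤ energyRect L H u :=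
  integral_nonneg fun _ => by positivity

/-- Pairing of `q` with finite sums of modes whose coefficients have mean zero in `y`. -/
theorem sq_integral_mul_re_modeSum_le {L H : ℝ} (hL : 0 < L) (hH : 0 < H) {q : ℝ × ℝ → ℝ}
    (hq : MemLp q 2 (volume.restrict (RectR L H))) {N₁ N₂ : ℝ}
    (hN₁ : ∀ u : ℝ × ℝ → ℝ, AdmRect L H u →
      |∫ p in RectR L H, q p * (fderiv ℝ u p (1, 0))| ≤ N₁ * Real.sqrt (energyRect L H u))
    (hN₂ : ∀ u : ℝ × ℝ → ℝ, AdmRect L H u →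
      |∫ p in RectR L H, q p * (fderiv ℝ u p (0, 1))| ≤ N₂ * Real.sqrt (energyRect L H u))
    (S : Finset ℤ) {g : ℤ → ℝ → ℂ} (hg : ∀ k, Continuous (g k))
    (hg0 : ∀ k, ∫ y in (0 : ℝ)..H, g k y = 0) :
    (∫ p in RectR L H, q p * (modeSum L S g p).re) ^ 2
      ≤ (N₁ ^ 2 + N₂ ^ 2) * (9 * (L * ∑ k ∈ S, ∫ y in (0 : ℝ)..H, ‖g k y‖ ^ 2)) := by
  have hfin := isFiniteMeasure_restrict_RectR L H
  choose a a' b b' ha hb hac hbc ha0 haH hb0 hbH hdiv hE using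
    fun k => exists_complex_mode H (xFreq L k) hH (g k) (hg k) (hg0 k)
  set u : ℝ × ℝ → ℝ := fun p => (modeSum L S a p).re with hu
  set v : ℝ × ℝ → ℝ := fun p => (modeSum L S b p).re with hv
  have hcont : ∀ {c c' : ℤ → ℝ → ℂ}, (∀ k t, HasDerivAt (c k) (c' k t) t) →
      ∀ k, Continuous (c k) := fun h k =>
    continuous_iff_continuousAt.2 fun t => (h k t).continuousAt
  have hca := hcont ha
  have hcb := hcont hb
  have hint : ∀ {c : ℤ → ℝ → ℂ}, (∀ k, Continuous (c k)) →
      Integrable (fun p => q p * (modeSum L S c p).re) (volume.restrict (RectR L H)) := by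
    intro c hc
    have hcm := continuous_modeSum L S hc
    have hre := Complex.continuous_re
    have h2 : MemLp (fun p => (modeSum L S c p).re) 2 (volume.restrict (RectR L H)) := by
      rw [memLp_two_iff_integrable_sq (Continuous.aestronglyMeasurable (by fun_prop))]
      exact Continuous.integrableOn_RectR (by fun_prop)
    exact hq.integrable_mul h2
  have hsplit : ∫ p in RectR L H, q p * (modeSum L S g p).re
      = (∫ p in RectR L H, q p * fderiv ℝ u p (1, 0))
        + ∫ p in RectR L H, q p * fderiv ℝ v p (0, 1) := by
    simp only [hu, hv, fderiv_re_modeSum_fst L S ha hac, fderiv_re_modeSum_snd L S hb hbc]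
    rw [← integral_add (hint fun k => by have := hca k; fun_prop) (hint hbc)]
    refine integral_congr_ae (Filter.Eventually.of_forall fun p => ?_)
    simp only
    rw [← mul_add, ← Complex.add_re, modeSum, modeSum, modeSum, ← Finset.sum_add_distrib]
    congr 2
    refine Finset.sum_congr rfl fun k _ => ?_
    rw [← hdiv k p.2]
    ring
  have h1 := hN₁ u (admRect_re_modeSum hL S ha hac ha0 haH)
  have h2 := hN₂ v (admRect_re_modeSum hL S hb hbc hb0 hbH)
  have hEn : energyRect L H u + energyRect L H v
      ≤ 9 * (L * ∑ k ∈ S, ∫ y in (0 : ℝ)..H, ‖g k y‖ ^ 2) := by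
    refine (add_le_add (energyRect_re_modeSum_le hL hH S ha hac)
      (energyRect_re_modeSum_le hL hH S hb hbc)).trans ?_
    rw [← mul_add, ← Finset.sum_add_distrib, mul_left_comm]
    refine mul_le_mul_of_nonneg_left ?_ hL.le
    rw [Finset.mul_sum]
    refine Finset.sum_le_sum fun k _ => ?_
    have ca := hca k
    have cb := hcb k
    have ca' := hac k
    have cb' := hbc k
    rw [← intervalIntegral.integral_add (Continuous.intervalIntegrable (by fun_prop) _ _)
      (Continuous.intervalIntegrable (by fun_prop) _ _)]
    exact hE k
  have hu0 := Real.sq_sqrt (energyRect_nonneg L H u)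
  have hv0 := Real.sq_sqrt (energyRect_nonneg L H v)
  set s := Real.sqrt (energyRect L H u)
  set t := Real.sqrt (energyRect L H v)
  have habs : |∫ p in RectR L H, q p * (modeSum L S g p).re| ≤ N₁ * s + N₂ * t := by
    rw [hsplit]
    exact (abs_add_le _ _).trans (add_le_add h1 h2)
  calc (∫ p in RectR L H, q p * (modeSum L S g p).re) ^ 2
      ≤ (N₁ * s + N₂ * t) ^ 2 := sq_le_sq' (abs_le.1 habs).1 (abs_le.1 habs).2
    _ ≤ (N₁ ^ 2 + N₂ ^ 2) * (s ^ 2 + t ^ 2) := by nlinarith [sq_nonneg (N₁ * t - N₂ * s)]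
    _ ≤ _ := mul_le_mul_of_nonneg_left (by rw [hu0, hv0]; exact hEn) (by positivity)

theorem sq_integral_mul_le {α : Type*} [MeasurableSpace α] {μ : Measure α} {f h : α → ℝ}
    (hf : MemLp f 2 μ) (hh : MemLp h 2 μ) :
    (∫ x, f x * h x ∂μ) ^ 2 ≤ (∫ x, f x ^ 2 ∂μ) * ∫ x, h x ^ 2 ∂μ := by
  have key : ∀ t : ℝ, 0 ≤ (∫ x, h x ^ 2 ∂μ) * (t * t) + (-2 * ∫ x, f x * h x ∂μ) * t
      + ∫ x, f x ^ 2 ∂μ := by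
    intro t
    have h1 : Integrable (fun x => (t * t) * h x ^ 2) μ := hh.integrable_sq.const_mul _
    have h2 : Integrable (fun x => (-2 * t) * (f x * h x)) μ :=
      (hf.integrable_mul hh).const_mul _
    have h0 : 0 ≤ ∫ x, ((t * t) * h x ^ 2 + (-2 * t) * (f x * h x)) + f x ^ 2 ∂μ :=
      integral_nonneg fun x => by
        change 0 ≤ ((t * t) * h x ^ 2 + (-2 * t) * (f x * h x)) + f x ^ 2
        nlinarith [sq_nonneg (f x - t * h x)]
    have h12 : Integrable (fun x => (t * t) * h x ^ 2 + (-2 * t) * (f x * h x)) μ := h1.add h2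
    rw [integral_add h12 hf.integrable_sq, integral_add h1 h2, integral_const_mul,
      integral_const_mul] at h0
    linarith
  have := discrim_le_zero key
  rw [discrim] at this
  nlinarith

section Expansion

variable {L H K : ℝ} {G : ℝ × ℝ → ℝ}

theorem Measurable.intervalIntegrable_of_bound {E : Type*} [NormedAddCommGroup E]
    [MeasurableSpace E] [BorelSpace E] [SecondCountableTopology E] {f : ℝ → E}
    (hf : Measurable f) (hb : ∀ x, ‖f x‖ ≤ K) (a b : ℝ) : IntervalIntegrable f volume a b :=
  (intervalIntegrable_const (c := K)).mono_fun' hf.aestronglyMeasurable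
    (Filter.Eventually.of_forall hb)

theorem continuous_xCoeff (hm : Measurable G) (hb : ∀ p, |G p| ≤ K)
    (hc : ∀ x, Continuous fun y => G (x, y)) (k : ℤ) :
    Continuous fun y => xCoeff L (fun x => (G (x, y) : ℂ)) k := by
  refine continuous_const.mul ?_
  have hmode := continuous_xMode L k
  refine intervalIntegral.continuous_of_dominated_interval (bound := fun _ => K)
    (fun y => ?_) (fun y => ?_) intervalIntegrable_const ?_
  · refine Measurable.aestronglyMeasurable ?_
    have : Measurable fun x => G (x, y) := hm.comp (by fun_prop)
    exact (continuous_star.comp hmode).measurable.mul (Complex.measurable_ofReal.comp this)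
  · refine Filter.Eventually.of_forall fun x _ => ?_
    rw [norm_mul, norm_star, norm_xMode, one_mul, Complex.norm_real]
    exact hb _
  · exact Filter.Eventually.of_forall fun x _ =>
      continuous_const.mul (Complex.continuous_ofReal.comp (hc x))

theorem integral_xCoeff_eq_zero (hm : Measurable G) (hb : ∀ p, |G p| ≤ K)
    (h0 : ∀ x, ∫ y in (0 : ℝ)..H, G (x, y) = 0) (k : ℤ) :
    ∫ y in (0 : ℝ)..H, xCoeff L (fun x => (G (x, y) : ℂ)) k = 0 := by
  have hmode := continuous_xMode L k
  simp only [xCoeff]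
  rw [intervalIntegral.integral_const_mul, intervalIntegral_intervalIntegral_swap]
  · simp_rw [intervalIntegral.integral_const_mul, intervalIntegral.integral_ofReal, h0]
    simp
  · have hfin : volume (uIoc 0 H ×ˢ uIoc 0 L) < ⊤ := by
      rw [Measure.volume_eq_prod, Measure.prod_prod]
      simp [uIoc, ENNReal.mul_lt_top]
    refine Measure.integrableOn_of_bounded (M := K) hfin.ne ?_ ?_
    · refine Measurable.aestronglyMeasurable ?_
      have h1 : Measurable fun p : ℝ × ℝ => G (p.2, p.1) := hm.comp measurable_swap
      exact ((continuous_star.comp hmode).comp continuous_snd).measurable.mul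
        (Complex.measurable_ofReal.comp h1)
    · refine Filter.Eventually.of_forall fun p => ?_
      rw [Function.uncurry, norm_mul, norm_star, norm_xMode, one_mul, Complex.norm_real]
      exact hb _

theorem Measurable.integrableOn_RectR {E : Type*} [NormedAddCommGroup E]
    [MeasurableSpace E] [BorelSpace E] [SecondCountableTopology E] {Φ : ℝ × ℝ → E}
    (hm : Measurable Φ) (hb : ∀ p, ‖Φ p‖ ≤ K) : IntegrableOn Φ (RectR L H) :=
  have := isFiniteMeasure_restrict_RectR L H
  Integrable.of_bound hm.aestronglyMeasurable K (Filter.Eventually.of_forall hb)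

theorem integrableOn_norm_sq_sub_modeSum (hm : Measurable G) (hb : ∀ p, |G p| ≤ K) (S : Finset ℤ)
    {g : ℤ → ℝ → ℂ} (hg : ∀ k, Continuous (g k)) :
    IntegrableOn (fun p => ‖(G p : ℂ) - modeSum L S g p‖ ^ 2) (RectR L H) := by
  have hfin := isFiniteMeasure_restrict_RectR L H
  have hs := continuous_modeSum L S hg
  refine MemLp.integrable_norm_pow (p := 2) (μ := volume.restrict (RectR L H)) ?_ two_ne_zero
  refine MemLp.sub ?_ ?_
  · refine MemLp.of_bound (Complex.measurable_ofReal.comp hm).aestronglyMeasurable K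
      (Filter.Eventually.of_forall fun p => ?_)
    exact (Complex.norm_real _).trans_le (hb p)
  · change MemLp (modeSum L S g) 2 (volume.restrict (RectR L H))
    exact (memLp_two_iff_integrable_sq_norm hs.aestronglyMeasurable).2
      (Continuous.integrableOn_RectR (by fun_prop))

theorem integral_norm_sq_sub_modeSum_xCoeff (hL : 0 < L) (hH : 0 < H) (hm : Measurable G)
    (hb : ∀ p, |G p| ≤ K) (hc : ∀ x, Continuous fun y => G (x, y)) (S : Finset ℤ) :
    ∫ p in RectR L H,
        ‖(G p : ℂ) - modeSum L S (fun k y => xCoeff L (fun x => (G (x, y) : ℂ)) k) p‖ ^ 2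
      = ∫ y in (0 : ℝ)..H, ((∫ x in (0 : ℝ)..L, ‖(G (x, y) : ℂ)‖ ^ 2)
          - L * ∑ k ∈ S, ‖xCoeff L (fun x => (G (x, y) : ℂ)) k‖ ^ 2) := by
  rw [setIntegral_RectR hL.le hH.le
    (integrableOn_norm_sq_sub_modeSum hm hb S (continuous_xCoeff hm hb hc))]
  refine intervalIntegral.integral_congr fun y _ => ?_
  have hy : Measurable fun x => (G (x, y) : ℂ) :=
    Complex.measurable_ofReal.comp (hm.comp (by fun_prop))
  have hyb : ∀ x, ‖(G (x, y) : ℂ)‖ ≤ K := fun x => by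
    rw [Complex.norm_real]; exact hb _
  refine integral_norm_sq_sub_partialSum hL.ne' S (hy.intervalIntegrable_of_bound hyb 0 L) ?_
  refine (hy.norm.pow_const 2).intervalIntegrable_of_bound (K := K ^ 2) (fun x => ?_) 0 L
  rw [norm_pow, norm_norm]
  exact pow_le_pow_left₀ (norm_nonneg _) (hyb x) 2

theorem continuous_integral_norm_sq (hm : Measurable G) (hb : ∀ p, |G p| ≤ K)
    (hc : ∀ x, Continuous fun y => G (x, y)) :
    Continuous fun y => ∫ x in (0 : ℝ)..L, ‖(G (x, y) : ℂ)‖ ^ 2 := by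
  refine intervalIntegral.continuous_of_dominated_interval (bound := fun _ => K ^ 2)
    (fun y => ?_) (fun y => ?_) intervalIntegrable_const ?_
  · have hy : Measurable fun x => (G (x, y) : ℂ) :=
      Complex.measurable_ofReal.comp (hm.comp (by fun_prop))
    exact (hy.norm.pow_const 2).aestronglyMeasurable
  · refine Filter.Eventually.of_forall fun x _ => ?_
    rw [norm_pow, norm_norm, Complex.norm_real]
    exact pow_le_pow_left₀ (norm_nonneg _) (hb _) 2
  · exact Filter.Eventually.of_forall fun x _ =>
      (Complex.continuous_ofReal.comp (hc x)).norm.pow 2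

theorem sum_integral_norm_sq_xCoeff_le (hL : 0 < L) (hH : 0 < H) (hm : Measurable G)
    (hb : ∀ p, |G p| ≤ K) (hc : ∀ x, Continuous fun y => G (x, y)) (S : Finset ℤ) :
    L * ∑ k ∈ S, ∫ y in (0 : ℝ)..H, ‖xCoeff L (fun x => (G (x, y) : ℂ)) k‖ ^ 2
      ≤ ∫ p in RectR L H, G p ^ 2 := by
  have h := integral_norm_sq_sub_modeSum_xCoeff hL hH hm hb hc S
  have h0 : 0 ≤ ∫ p in RectR L H,
      ‖(G p : ℂ) - modeSum L S (fun k y => xCoeff L (fun x => (G (x, y) : ℂ)) k) p‖ ^ 2 :=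
    integral_nonneg fun _ => by positivity
  have hcc := fun k => continuous_xCoeff (L := L) hm hb hc k
  have hci := continuous_integral_norm_sq (L := L) hm hb hc
  have hG : ∫ p in RectR L H, G p ^ 2
      = ∫ y in (0 : ℝ)..H, ∫ x in (0 : ℝ)..L, ‖(G (x, y) : ℂ)‖ ^ 2 := by
    rw [setIntegral_RectR hL.le hH.le
      ((hm.pow_const 2).integrableOn_RectR (K := K ^ 2) fun p => ?_)]
    · simp only [Complex.norm_real, Real.norm_eq_abs, sq_abs]
    · rw [norm_pow]
      exact pow_le_pow_left₀ (norm_nonneg _) (hb p) 2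
  rw [intervalIntegral.integral_sub (hci.intervalIntegrable _ _)
    (Continuous.intervalIntegrable (by fun_prop) _ _), intervalIntegral.integral_const_mul,
    intervalIntegral.integral_finsetSum
      fun k _ => Continuous.intervalIntegrable (by have := hcc k; fun_prop) _ _] at h
  linarith

theorem tendsto_integral_norm_sq_sub_modeSum (hL : 0 < L) (hH : 0 < H) (hm : Measurable G)
    (hb : ∀ p, |G p| ≤ K) (hc : ∀ x, Continuous fun y => G (x, y)) :
    Filter.Tendsto (fun S : Finset ℤ => ∫ p in RectR L H,
        ‖(G p : ℂ) - modeSum L S (fun k y => xCoeff L (fun x => (G (x, y) : ℂ)) k) p‖ ^ 2)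
      Filter.atTop (nhds 0) := by
  simp only [integral_norm_sq_sub_modeSum_xCoeff hL hH hm hb hc]
  have hcc := fun k => continuous_xCoeff (L := L) hm hb hc k
  have hci := continuous_integral_norm_sq (L := L) hm hb hc
  have hsum : ∀ y, HasSum (fun k => L * ‖xCoeff L (fun x => (G (x, y) : ℂ)) k‖ ^ 2)
      (∫ x in (0 : ℝ)..L, ‖(G (x, y) : ℂ)‖ ^ 2) := by
    intro y
    refine hasSum_norm_sq_xCoeff hL (MemLp.of_bound ?_ K (Filter.Eventually.of_forall fun x => ?_))
    · exact (Complex.measurable_ofReal.comp (hm.comp (by fun_prop))).aestronglyMeasurable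
    · rw [Complex.norm_real]
      exact hb _
  have hcont : ∀ S : Finset ℤ, Continuous fun y => (∫ x in (0 : ℝ)..L, ‖(G (x, y) : ℂ)‖ ^ 2)
      - L * ∑ k ∈ S, ‖xCoeff L (fun x => (G (x, y) : ℂ)) k‖ ^ 2 := fun S => by fun_prop
  have h0 : ∫ _ in (0 : ℝ)..H, (0 : ℝ) = 0 := intervalIntegral.integral_zero
  conv in nhds 0 => rw [← h0]
  refine intervalIntegral.tendsto_integral_filter_of_dominated_convergence
    (fun y => ∫ x in (0 : ℝ)..L, ‖(G (x, y) : ℂ)‖ ^ 2)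
    (Filter.Eventually.of_forall fun S => (hcont S).aestronglyMeasurable)
    (Filter.Eventually.of_forall fun S => Filter.Eventually.of_forall fun y _ => ?_)
    (hci.intervalIntegrable _ _) (Filter.Eventually.of_forall fun y _ => ?_)
  · have h1 := sum_le_hasSum S (fun _ _ => by positivity) (hsum y)
    rw [← Finset.mul_sum] at h1
    rw [Real.norm_of_nonneg (by linarith), sub_le_self_iff]
    positivity
  · have h1 : Filter.Tendsto (fun S : Finset ℤ =>
        ∑ k ∈ S, L * ‖xCoeff L (fun x => (G (x, y) : ℂ)) k‖ ^ 2) Filter.atTop _ := hsum y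
    simp only [← Finset.mul_sum] at h1
    have h2 := h1.const_sub (∫ x in (0 : ℝ)..L, ‖(G (x, y) : ℂ)‖ ^ 2)
    rwa [sub_self] at h2

/-- Pairing of `q` with a bounded function, continuous in `y`, all of whose columns have mean
zero: the modes of its Fourier series in `x` are treated one by one. -/
theorem sq_integral_mul_le_of_mean_zero (hL : 0 < L) (hH : 0 < H) {q : ℝ × ℝ → ℝ}
    (hq : MemLp q 2 (volume.restrict (RectR L H))) {N₁ N₂ : ℝ}
    (hN₁ : ∀ u : ℝ × ℝ → ℝ, AdmRect L H u →
      |∫ p in RectR L H, q p * (fderiv ℝ u p (1, 0))| ≤ N₁ * Real.sqrt (energyRect L H u))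
    (hN₂ : ∀ u : ℝ × ℝ → ℝ, AdmRect L H u →
      |∫ p in RectR L H, q p * (fderiv ℝ u p (0, 1))| ≤ N₂ * Real.sqrt (energyRect L H u))
    (hm : Measurable G) (hb : ∀ p, |G p| ≤ K) (hc : ∀ x, Continuous fun y => G (x, y))
    (h0 : ∀ x, ∫ y in (0 : ℝ)..H, G (x, y) = 0) :
    (∫ p in RectR L H, q p * G p) ^ 2
      ≤ 9 * (N₁ ^ 2 + N₂ ^ 2) * ∫ p in RectR L H, G p ^ 2 := by
  have hfin := isFiniteMeasure_restrict_RectR L H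
  set g : ℤ → ℝ → ℂ := fun k y => xCoeff L (fun x => (G (x, y) : ℂ)) k with hgdef
  have hg : ∀ k, Continuous (g k) := continuous_xCoeff hm hb hc
  have hg0 : ∀ k, ∫ y in (0 : ℝ)..H, g k y = 0 := integral_xCoeff_eq_zero hm hb h0
  set A := 9 * (N₁ ^ 2 + N₂ ^ 2) * ∫ p in RectR L H, G p ^ 2
  set D : Finset ℤ → ℝ := fun S => ∫ p in RectR L H, ‖(G p : ℂ) - modeSum L S g p‖ ^ 2
  have hD0 : Filter.Tendsto D Filter.atTop (nhds 0) :=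
    tendsto_integral_norm_sq_sub_modeSum hL hH hm hb hc
  have hGL : MemLp G 2 (volume.restrict (RectR L H)) :=
    MemLp.of_bound hm.aestronglyMeasurable K (Filter.Eventually.of_forall hb)
  have hbound : ∀ S, |∫ p in RectR L H, q p * G p|
      ≤ Real.sqrt A + Real.sqrt ((∫ p in RectR L H, q p ^ 2) * D S) := by
    intro S
    have hs := continuous_modeSum L S hg
    have hre : Continuous fun p => (modeSum L S g p).re := Complex.continuous_re.comp hs
    have hsL : MemLp (fun p => (modeSum L S g p).re) 2 (volume.restrict (RectR L H)) := by
      rw [memLp_two_iff_integrable_sq hre.aestronglyMeasurable]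
      exact Continuous.integrableOn_RectR (by fun_prop)
    have hdL : MemLp (fun p => G p - (modeSum L S g p).re) 2 (volume.restrict (RectR L H)) :=
      hGL.sub hsL
    have hsplit : ∫ p in RectR L H, q p * G p = (∫ p in RectR L H, q p * (modeSum L S g p).re)
        + ∫ p in RectR L H, q p * (G p - (modeSum L S g p).re) := by
      have i1 : Integrable (fun p => q p * (modeSum L S g p).re) (volume.restrict (RectR L H)) :=
        hq.integrable_mul hsL
      have i2 : Integrable (fun p => q p * (G p - (modeSum L S g p).re))
          (volume.restrict (RectR L H)) := hq.integrable_mul hdL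
      rw [← integral_add i1 i2]
      exact integral_congr_ae (Filter.Eventually.of_forall fun p => by
        change _ = q p * _ + q p * _
        ring)
    rw [hsplit]
    refine (abs_add_le _ _).trans (add_le_add (Real.abs_le_sqrt ?_) (Real.abs_le_sqrt ?_))
    · refine (sq_integral_mul_re_modeSum_le hL hH hq hN₁ hN₂ S hg hg0).trans ?_
      have := mul_le_mul_of_nonneg_left (sum_integral_norm_sq_xCoeff_le hL hH hm hb hc S)
        (by positivity : 0 ≤ 9 * (N₁ ^ 2 + N₂ ^ 2))
      simp only [A, hgdef]
      linarith
    · refine (sq_integral_mul_le hq hdL).trans (mul_le_mul_of_nonneg_left ?_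
        (integral_nonneg fun _ => by positivity))
      refine integral_mono hdL.integrable_sq
        (integrableOn_norm_sq_sub_modeSum hm hb S hg) fun p => ?_
      have h := Complex.abs_re_le_norm ((G p : ℂ) - modeSum L S g p)
      rw [Complex.sub_re, Complex.ofReal_re] at h
      exact sq_le_sq' (by linarith [neg_abs_le (G p - (modeSum L S g p).re)])
        ((le_abs_self _).trans h)
  have hlim : Filter.Tendsto
      (fun S => Real.sqrt A + Real.sqrt ((∫ p in RectR L H, q p ^ 2) * D S)) Filter.atTop
      (nhds (Real.sqrt A)) := by
    have := ((hD0.const_mul (∫ p in RectR L H, q p ^ 2)).sqrt).const_add (Real.sqrt A)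
    simpa using this
  have hA : 0 ≤ A := by
    have : 0 ≤ ∫ p in RectR L H, G p ^ 2 := integral_nonneg fun _ => by positivity
    positivity
  have hfinal := ge_of_tendsto' hlim hbound
  calc (∫ p in RectR L H, q p * G p) ^ 2 ≤ Real.sqrt A ^ 2 :=
        sq_le_sq' (abs_le.1 hfinal).1 (abs_le.1 hfinal).2
    _ = A := Real.sq_sqrt hA

end Expansion

theorem integral_fderiv_snd_eq_zero {L H : ℝ} {u : ℝ × ℝ → ℝ} (hu : AdmRect L H u) (x : ℝ) :
    ∫ y in (0 : ℝ)..H, fderiv ℝ u (x, y) (0, 1) = 0 := by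
  obtain ⟨hC, -, h0, hH⟩ := hu
  have hd : ∀ y, HasDerivAt (fun y => u (x, y)) (fderiv ℝ u (x, y) (0, 1)) y := fun y =>
    ((hC.differentiable one_ne_zero) (x, y)).hasFDerivAt.comp_hasDerivAt y
      ((hasDerivAt_const y x).prodMk (hasDerivAt_id y))
  have hcont : Continuous fun p => fderiv ℝ u p (0, 1) :=
    (hC.continuous_fderiv one_ne_zero).clm_apply continuous_const
  rw [intervalIntegral.integral_eq_sub_of_hasDerivAt (fun y _ => hd y)
    (Continuous.intervalIntegrable (hcont.comp (by fun_prop)) _ _), h0, hH, sub_zero]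

/-- Corollary 3.4: for `ζ ∈ L^∞(T)` with `‖ζ‖_∞ ≤ M` (depending only on `x`,
`L`-periodic) and every mean-zero `q ∈ L²(R)`,
`‖∂_y(ζq)‖₋₁² ≤ 9M²(‖∂ₓq‖₋₁² + ‖∂_y q‖₋₁²)` for every aspect ratio `H/L`.
The dual norms on the right are encoded by bounds `N₁, N₂` on the pairings of
`∂ₓq, ∂_y q` with test functions; the conclusion bounds the pairing
`⟨∂_y(ζq), u⟩ = −∫ ζ q ∂_y u` for every test function. -/
theorem multiplier_dual_bound (L H : ℝ) (hL : 0 < L) (hH : 0 < H)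
    (ζ : ℝ → ℝ) (hζm : Measurable ζ) (M : ℝ) (hM : ∀ x, |ζ x| ≤ M)
    (hζper : ∀ x, ζ (x + L) = ζ x)
    (q : ℝ × ℝ → ℝ)
    (hq2 : MeasureTheory.IntegrableOn (fun p => (q p) ^ 2) (RectR L H))
    (hq1 : MeasureTheory.IntegrableOn q (RectR L H))
    (hmean : ∫ p in RectR L H, q p = 0)
    (N₁ N₂ : ℝ)
    (hN₁ : ∀ u : ℝ × ℝ → ℝ, AdmRect L H u →
      |∫ p in RectR L H, q p * (fderiv ℝ u p (1, 0))|
        ≤ N₁ * Real.sqrt (energyRect L H u))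
    (hN₂ : ∀ u : ℝ × ℝ → ℝ, AdmRect L H u →
      |∫ p in RectR L H, q p * (fderiv ℝ u p (0, 1))|
        ≤ N₂ * Real.sqrt (energyRect L H u)) :
    ∀ u : ℝ × ℝ → ℝ, AdmRect L H u →
      (∫ p in RectR L H, ζ p.1 * q p * (fderiv ℝ u p (0, 1))) ^ 2
        ≤ 9 * M ^ 2 * (N₁ ^ 2 + N₂ ^ 2) * energyRect L H u := by
  intro u hu
  have hfin := isFiniteMeasure_restrict_RectR L H
  have hqL : MemLp q 2 (volume.restrict (RectR L H)) :=
    (memLp_two_iff_integrable_sq hq1.aestronglyMeasurable).2 hq2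
  have hcont1 : Continuous fun p => fderiv ℝ u p (1, 0) :=
    (hu.1.continuous_fderiv one_ne_zero).clm_apply continuous_const
  have hcont : Continuous fun p => fderiv ℝ u p (0, 1) :=
    (hu.1.continuous_fderiv one_ne_zero).clm_apply continuous_const
  set π : ℝ → ℝ → ℝ := fun b t => max 0 (min t b) with hπ
  have hπc : ∀ b, Continuous (π b) := fun b => by fun_prop
  have hπm : ∀ {b : ℝ}, 0 ≤ b → ∀ t, π b t ∈ Icc 0 b := fun hb t =>
    ⟨le_max_left _ _, max_le hb (min_le_right _ _)⟩
  have hπe : ∀ {b t : ℝ}, t ∈ Icc 0 b → π b t = t := fun ht => by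
    simp only [hπ, min_eq_left ht.2, max_eq_right ht.1]
  obtain ⟨C, hC⟩ := (isCompact_Icc.prod isCompact_Icc :
    IsCompact (Icc 0 L ×ˢ Icc 0 H)).exists_bound_of_continuousOn hcont.continuousOn
  set G : ℝ × ℝ → ℝ := fun p => ζ p.1 * fderiv ℝ u (π L p.1, π H p.2) (0, 1) with hG
  have hGD : ∀ p ∈ RectR L H, G p = ζ p.1 * fderiv ℝ u p (0, 1) := fun p hp => by
    simp only [hG, hπe (Ioo_subset_Icc_self hp.1), hπe (Ioo_subset_Icc_self hp.2)]
  have hDc : Continuous fun p : ℝ × ℝ => fderiv ℝ u (π L p.1, π H p.2) (0, 1) := by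
    have h1 := hπc L
    have h2 := hπc H
    exact hcont.comp (by fun_prop)
  have hM0 : 0 ≤ M := (abs_nonneg _).trans (hM 0)
  have hGm : Measurable G := (hζm.comp measurable_fst).mul hDc.measurable
  have hGb : ∀ p, |G p| ≤ M * C := fun p => by
    rw [hG, abs_mul]
    exact mul_le_mul (hM _) (hC _ ⟨hπm hL.le _, hπm hH.le _⟩) (abs_nonneg _) hM0
  have hGc : ∀ x, Continuous fun y => G (x, y) := fun x =>
    (hDc.comp (Continuous.prodMk_right x)).const_mul (ζ x)
  have hG0 : ∀ x, ∫ y in (0 : ℝ)..H, G (x, y) = 0 := fun x => by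
    simp only [hG]
    rw [intervalIntegral.integral_const_mul,
      intervalIntegral.integral_congr (g := fun y => fderiv ℝ u (π L x, y) (0, 1)),
      integral_fderiv_snd_eq_zero hu, mul_zero]
    intro y hy
    rw [uIcc_of_le hH.le] at hy
    simp only [hπe hy]
  have hmeas : MeasurableSet (RectR L H) := measurableSet_Ioo.prod measurableSet_Ioo
  have hE : ∫ p in RectR L H, G p ^ 2 ≤ M ^ 2 * energyRect L H u := by
    have hcontE : Continuous fun p =>
        M ^ 2 * ((fderiv ℝ u p (1, 0)) ^ 2 + (fderiv ℝ u p (0, 1)) ^ 2) := by fun_prop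
    rw [energyRect, ← integral_const_mul]
    refine setIntegral_mono_on ((hGm.pow_const 2).integrableOn_RectR (K := (M * C) ^ 2)
      fun p => ?_) (Continuous.integrableOn_RectR hcontE) hmeas fun p hp => ?_
    · rw [norm_pow]
      exact pow_le_pow_left₀ (norm_nonneg _) (hGb p) 2
    · rw [hGD p hp, mul_pow]
      have h1 : ζ p.1 ^ 2 ≤ M ^ 2 := sq_le_sq' (abs_le.1 (hM p.1)).1 (abs_le.1 (hM p.1)).2
      exact mul_le_mul h1 (le_add_of_nonneg_left (sq_nonneg _)) (sq_nonneg _) (sq_nonneg _)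
  have hmain := sq_integral_mul_le_of_mean_zero hL hH hqL hN₁ hN₂ hGm hGb hGc hG0
  have hI : ∫ p in RectR L H, ζ p.1 * q p * (fderiv ℝ u p (0, 1))
      = ∫ p in RectR L H, q p * G p :=
    setIntegral_congr_fun hmeas fun p hp => by
      simp only [hGD p hp]
      ring
  rw [hI]
  calc _ ≤ _ := hmain
    _ ≤ 9 * (N₁ ^ 2 + N₂ ^ 2) * (M ^ 2 * energyRect L H u) :=
      mul_le_mul_of_nonneg_left hE (by positivity)
    _ = _ := by ring
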